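/- Let k = ℚ(√α), where α is a positive square-free integer with α ≡ 1 (mod 4), and let O_k be its ring of integers. Let x, y be elements of O_k, and let m be a positive integer and n a nonnegative integer. Then there exist an integer h ∈ ℤ and an element β ∈ O_k such that: if [h β] lies in EBIG^n_m(O_k), then the matrix [x y] lies in EBIG^{n+3}_{m+24}(O_k). -/

import Mathlib

open Matrix NumberField

/-- A 2×2 matrix `M` over an integral domain `R` lies in `EBIG n m` if there exist
`s ≤ n` matrices `E₁, …, E_s` in `SL₂(R)` and `1 ≤ r ≤ m` idempotent matrices
`A₁, …, A_r` such that `(E₁⋯E_s)⁻¹ M (E₁⋯E_s) = A₁ A₂ ⋯ A_r`. -/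
def EBIG {R : Type*} [CommRing R] (n m : ℕ) (M : Matrix (Fin 2) (Fin 2) R) : Prop :=
  ∃ s : ℕ, s ≤ n ∧ ∃ E : Fin s → Matrix.SpecialLinearGroup (Fin 2) R,
    ∃ r : ℕ, 1 ≤ r ∧ r ≤ m ∧ ∃ A : Fin r → Matrix (Fin 2) (Fin 2) R,
      (∀ i, A i * A i = A i) ∧
      (((List.ofFn E).prod⁻¹ : Matrix.SpecialLinearGroup (Fin 2) R) :
          Matrix (Fin 2) (Fin 2) R) * M *
        ((List.ofFn E).prod : Matrix (Fin 2) (Fin 2) R) = (List.ofFn A).prod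


/-- `M` is a product of between one and `m` idempotents. -/
def PI7 {R : Type*} [CommRing R] (m : ℕ) (M : Matrix (Fin 2) (Fin 2) R) : Prop :=
  ∃ L : List (Matrix (Fin 2) (Fin 2) R), 1 ≤ L.length ∧ L.length ≤ m ∧
    (∀ A ∈ L, A * A = A) ∧ M = L.prod

section PI
variable {R : Type*} [CommRing R]

lemma PI7.conj {m : ℕ} {M P Q : Matrix (Fin 2) (Fin 2) R} (h : PI7 m M)
    (hPQ : P * Q = 1) (hQP : Q * P = 1) : PI7 m (P * M * Q) := by
  obtain ⟨L, h1, h2, h3, rfl⟩ := h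
  refine ⟨L.map (fun A => P * A * Q), by simpa using h1, by simpa using h2, ?_, ?_⟩
  · intro B hB
    obtain ⟨A, hA, rfl⟩ := List.mem_map.1 hB
    calc P * A * Q * (P * A * Q) = P * A * (Q * P) * A * Q := by simp only [mul_assoc]
      _ = P * (A * A) * Q := by rw [hQP]; simp only [mul_assoc, one_mul]
      _ = P * A * Q := by rw [h3 A hA]
  · clear h1 h2 h3
    induction L with
    | nil => simp [hPQ]
    | cons A L ih =>
      rw [List.map_cons, List.prod_cons, List.prod_cons, ← ih]
      calc P * (A * L.prod) * Q = P * A * 1 * L.prod * Q := by simp only [mul_assoc, one_mul]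
        _ = P * A * (Q * P) * L.prod * Q := by rw [hQP]
        _ = P * A * Q * (P * L.prod * Q) := by simp only [mul_assoc]

lemma PI7.of_EBIG {n m : ℕ} {M : Matrix (Fin 2) (Fin 2) R} (h : EBIG n m M) : PI7 m M := by
  obtain ⟨s, -, E, r, h1, h2, A, hA, hM⟩ := h
  have h0 : PI7 m ((List.ofFn A).prod) := by
    refine ⟨List.ofFn A, by simpa using h1, by simpa using h2, ?_, rfl⟩
    intro B hB
    obtain ⟨i, rfl⟩ := (List.mem_ofFn' A B).1 hB
    exact hA i
  generalize (List.ofFn E).prod = S at hM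
  have hS1 : (S : Matrix (Fin 2) (Fin 2) R) * ((S⁻¹ : SpecialLinearGroup (Fin 2) R) :
      Matrix (Fin 2) (Fin 2) R) = 1 := by
    exact congrArg Subtype.val (mul_inv_cancel S)
  have hS2 : ((S⁻¹ : SpecialLinearGroup (Fin 2) R) :
      Matrix (Fin 2) (Fin 2) R) * (S : Matrix (Fin 2) (Fin 2) R) = 1 := by
    exact congrArg Subtype.val (inv_mul_cancel S)
  have h3 := h0.conj hS1 hS2
  rw [← hM] at h3
  have : (S : Matrix (Fin 2) (Fin 2) R) * (((S⁻¹ : SpecialLinearGroup (Fin 2) R) :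
      Matrix (Fin 2) (Fin 2) R) * M * (S : Matrix (Fin 2) (Fin 2) R)) *
      ((S⁻¹ : SpecialLinearGroup (Fin 2) R) : Matrix (Fin 2) (Fin 2) R) = M := by
    rw [mul_assoc, mul_assoc, mul_assoc, hS1, mul_one, ← mul_assoc, hS1, one_mul]
  rwa [this] at h3

lemma PI7.to_EBIG {n m : ℕ} {M : Matrix (Fin 2) (Fin 2) R} (h : PI7 m M) : EBIG n m M := by
  obtain ⟨L, h1, h2, h3, rfl⟩ := h
  refine ⟨0, Nat.zero_le _, Fin.elim0, L.length, h1, h2, fun i => L.get i, ?_, ?_⟩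
  · intro i
    exact h3 _ (List.get_mem _ _)
  · rw [List.ofFn_get]
    simp

lemma PI7.mono {m k : ℕ} (hmk : m ≤ k) {M : Matrix (Fin 2) (Fin 2) R} (h : PI7 m M) :
    PI7 k M := by
  obtain ⟨L, h1, h2, h3⟩ := h
  exact ⟨L, h1, h2.trans hmk, h3⟩

lemma PI7.shear {m : ℕ} {x y : R} (h : PI7 m !![x, y; 0, 0]) (t : R) :
    PI7 m !![x, y + t * x; 0, 0] := by
  have := h.conj (P := !![1, -t; 0, 1]) (Q := !![1, t; 0, 1])
    (by simp [Matrix.one_fin_two]) (by simp [Matrix.one_fin_two])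
  convert this using 1
  simp [mul_comm, add_comm]

lemma PI7.swap {m : ℕ} {x y : R} (h : PI7 m !![x, y; 0, 0]) :
    PI7 (m + 1) !![y, x; 0, 0] := by
  have := h.conj (P := !![0, 1; 1, 0]) (Q := !![0, 1; 1, 0])
    (by simp [Matrix.one_fin_two]) (by simp [Matrix.one_fin_two])
  obtain ⟨L, h1, h2, h3, h4⟩ := this
  refine ⟨!![1, 1; 0, 0] :: L, by simp, by simpa using h2, ?_, ?_⟩
  · intro A hA
    rcases List.mem_cons.1 hA with rfl | hA
    · ext i j; fin_cases i <;> fin_cases j <;> simp [Matrix.mul_apply]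
    · exact h3 A hA
  · rw [List.prod_cons, ← h4]
    simp

end PI

lemma exists_avoid {R : Type*} [CommRing R] (x y : R) (n : ℤ) (hn : n ≠ 0)
    (H : ∀ p : ℕ, p.Prime → (p : ℤ) ∣ n → ¬ ((p : R) ∣ x ∧ (p : R) ∣ y)) :
    ∃ t : ℤ, ∀ p : ℕ, p.Prime → (p : ℤ) ∣ n → ¬ ((p : R) ∣ y + t * x) := by
  classical
  set S : Finset ℕ := n.natAbs.primeFactors.filter (fun p : ℕ => ¬ ((p : R) ∣ y)) with hS
  refine ⟨((∏ p ∈ S, p : ℕ) : ℤ), ?_⟩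
  intro p hp hpn hd
  by_cases hy : (p : R) ∣ y
  · have hx : (p : R) ∣ (((∏ p ∈ S, p : ℕ) : ℤ) : R) * x := (dvd_add_right hy).1 hd
    have hcop : Nat.Coprime p (∏ p ∈ S, p) := by
      apply Nat.Coprime.prod_right
      intro q hq
      rw [hS, Finset.mem_filter] at hq
      rw [Nat.coprime_primes hp (Nat.prime_of_mem_primeFactors hq.1)]
      rintro rfl
      exact hq.2 hy
    have hc : IsCoprime (p : R) (((∏ p ∈ S, p : ℕ) : ℤ) : R) := by
      have := (Nat.isCoprime_iff_coprime.2 hcop).map (Int.castRingHom R)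
      simpa using this
    exact H p hp hpn ⟨hc.dvd_of_dvd_mul_left hx, hy⟩
  · have hpS : p ∈ S := by
      rw [hS, Finset.mem_filter]
      exact ⟨Nat.mem_primeFactors.2 ⟨hp, Int.natCast_dvd.1 hpn, by simpa using hn⟩, hy⟩
    have h1 : (p : R) ∣ (((∏ p ∈ S, p : ℕ) : ℤ) : R) * x := by
      apply Dvd.dvd.mul_right
      rw [Int.cast_natCast]
      exact Nat.cast_dvd_cast (Finset.dvd_prod_of_mem (fun p => p) hpS)
    exact hy ((dvd_add_left h1).1 hd)

lemma exists_functional_gen (R : Type*) [CommRing R] [Module.Free ℤ R] [Module.Finite ℤ R]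
    [Nontrivial R]
    (hr : Module.finrank ℤ R = 2)
    (hsat : ∀ (n c : ℤ) (z : R), n ≠ 0 → (n : R) * z = c → ∃ d : ℤ, z = d) :
    ∃ l : R →ₗ[ℤ] ℤ, (∃ w, l w = 1) ∧ ∀ z, l z = 0 ↔ ∃ c : ℤ, z = (c : R) := by
  let N : Submodule ℤ R := Submodule.span ℤ {1}
  have hN : ∀ z, z ∈ N ↔ ∃ c : ℤ, z = (c : R) := by
    intro z
    rw [Submodule.mem_span_singleton]
    simp [eq_comm]
  have htf : Module.IsTorsionFree ℤ (R ⧸ N) := by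
    rw [Module.isTorsionFree_iff_smul_eq_zero]
    intro n z hz
    obtain ⟨z, rfl⟩ := N.mkQ_surjective z
    by_cases hn : n = 0
    · exact Or.inl hn
    right
    rw [← map_smul, Submodule.mkQ_apply, Submodule.Quotient.mk_eq_zero, hN] at hz
    obtain ⟨c, hc⟩ := hz
    rw [Submodule.mkQ_apply, Submodule.Quotient.mk_eq_zero, hN]
    exact hsat n c z hn (by rw [← hc, zsmul_eq_mul])
  have hf1 : Module.finrank ℤ N = 1 := by
    have : Module.IsTorsionFree ℤ R := inferInstance
    have e := (LinearEquiv.toSpanNonzeroSingleton ℤ R 1 one_ne_zero).finrank_eq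
    rw [Module.finrank_self] at e
    exact e.symm
  have hq : Module.finrank ℤ (R ⧸ N) = 1 := by
    have := Submodule.finrank_quotient_add_finrank N
    omega
  have : Module.Free ℤ (R ⧸ N) := inferInstance
  let e : (R ⧸ N) ≃ₗ[ℤ] ℤ := LinearEquiv.ofFinrankEq _ _ (by rw [hq, Module.finrank_self])
  refine ⟨e.toLinearMap ∘ₗ N.mkQ, ?_, ?_⟩
  · obtain ⟨w, hw⟩ := N.mkQ_surjective (e.symm 1)
    exact ⟨w, by rw [LinearMap.comp_apply, hw]; simp⟩
  · intro z
    rw [← hN, LinearMap.comp_apply, LinearEquiv.coe_coe, LinearEquiv.map_eq_zero_iff,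
      Submodule.mkQ_apply, Submodule.Quotient.mk_eq_zero]

lemma exists_functional (K : Type*) [Field K] [NumberField K]
    (hrank : Module.finrank ℚ K = 2) :
    ∃ l : 𝓞 K →ₗ[ℤ] ℤ, (∃ w, l w = 1) ∧ ∀ z, l z = 0 ↔ ∃ c : ℤ, z = (c : 𝓞 K) := by
  refine exists_functional_gen (𝓞 K) (by rw [RingOfIntegers.rank, hrank]) ?_
  intro n c z hn h
  have hz : IsIntegral ℤ (z : K) := z.2
  have hnK : (n : K) ≠ 0 := by exact_mod_cast hn
  have hzq : (z : K) = algebraMap ℚ K ((c : ℚ) / n) := by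
    have := congrArg (algebraMap (𝓞 K) K) h
    simp only [map_mul, map_intCast] at this
    rw [map_div₀, map_intCast, map_intCast, eq_div_iff hnK, mul_comm]
    exact this
  rw [hzq, isIntegral_algebraMap_iff (algebraMap ℚ K).injective,
    IsIntegrallyClosed.isIntegral_iff] at hz
  obtain ⟨d, hd⟩ := hz
  refine ⟨d, RingOfIntegers.ext ?_⟩
  rw [hzq, ← hd]
  simp

section Main
variable {R : Type*} [CommRing R] [IsDomain R] [CharZero R] (l : R →ₗ[ℤ] ℤ) {w : R} (hw : l w = 1)
  (hl : ∀ z, l z = 0 ↔ ∃ c : ℤ, z = (c : R))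
include hw hl

lemma rep7 (z : R) : ∃ c : ℤ, z = c + (l z : ℤ) * w := by
  obtain ⟨c, hc⟩ := (hl (z - (l z) • w)).1 (by rw [map_sub, map_smul, hw]; simp)
  exact ⟨c, by rw [← hc]; simp⟩

lemma l_cast_mul (c : ℤ) (z : R) : l ((c : R) * z) = c * l z := by
  rw [← zsmul_eq_mul, map_zsmul, smul_eq_mul]

lemma l_cast (c : ℤ) : l (c : R) = 0 := (hl _).2 ⟨c, rfl⟩

lemma dvd7 (g c d : ℤ) : (g : R) ∣ c + d * w ↔ g ∣ c ∧ g ∣ d := by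
  constructor
  · rintro ⟨z, hz⟩
    have h1 : d = g * l z := by
      have := congrArg l hz
      rwa [map_add, l_cast l hw hl, l_cast_mul l hw hl, l_cast_mul l hw hl, hw, zero_add,
        mul_one] at this
    obtain ⟨e, he⟩ := rep7 l hw hl z
    refine ⟨⟨e, ?_⟩, ⟨_, h1⟩⟩
    have h2 : (c : R) + d * w = (g * e : ℤ) + (g * l z : ℤ) * w := by
      rw [hz]; nth_rewrite 1 [he]; push_cast; ring
    rw [← h1] at h2
    exact_mod_cast add_right_cancel h2
  · rintro ⟨⟨a, rfl⟩, ⟨b, rfl⟩⟩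
    exact ⟨a + b * w, by push_cast; ring⟩

/-- primitive `y`: any `x` can be moved into `ℤ`. -/
lemma to_int7 (x y : R) (hy : ∀ p : ℕ, p.Prime → ¬ (p : R) ∣ y) :
    ∃ (s : R) (h : ℤ), x + s * y = h := by
  let I : Ideal ℤ := (LinearMap.range (l ∘ₗ LinearMap.mulRight ℤ y))
  have hI : ∀ s, l (s * y) ∈ I := fun s => ⟨s, by simp⟩
  obtain ⟨g, hg⟩ := (IsPrincipalIdealRing.principal I).1
  have hI' : ∀ s, g ∣ l (s * y) := fun s => by
    have := hI s
    rw [hg] at this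
    exact Ideal.mem_span_singleton.1 this
  have hgy : (g : R) ∣ y := by
    obtain ⟨c, hc⟩ := rep7 l hw hl y
    have h1 : g ∣ l y := by simpa using hI' 1
    have h2 : l (w * y) = c + l y * l (w * w) := by
      have : w * y = c * w + (l y : ℤ) * (w * w) := by nth_rewrite 1 [hc]; ring
      rw [this, map_add, l_cast_mul l hw hl, l_cast_mul l hw hl, hw, mul_one]
    have h3 := hI' w
    rw [h2] at h3
    have h4 : g ∣ c := (dvd_add_left (h1.mul_right _)).1 h3
    rw [hc]
    exact (dvd7 l hw hl g c (l y)).2 ⟨h4, h1⟩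
  have hu : IsUnit g := by
    rw [Int.isUnit_iff_natAbs_eq]
    by_contra hne
    obtain ⟨p, hp, hpg⟩ := Nat.exists_prime_and_dvd hne
    apply hy p hp
    refine dvd_trans ?_ hgy
    have := map_dvd (Int.castRingHom R) (Int.natCast_dvd.2 hpg)
    simpa using this
  have hmem : -(l x) ∈ I := by
    rw [hg]
    exact Ideal.mem_span_singleton.2 (hu.dvd)
  obtain ⟨s, hs⟩ := hmem
  obtain ⟨h, hh⟩ := (hl (x + s * y)).1 (by
    have : l (s * y) = - l x := by simpa using hs
    rw [map_add, this]; ring)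
  exact ⟨s, h, hh⟩

lemma exists_prim7 (x y : R) (n : ℤ) (hn : n ≠ 0) (hxn : x ∣ (n : R))
    (hxy : ∀ p : ℕ, p.Prime → ¬ ((p : R) ∣ x ∧ (p : R) ∣ y)) :
    ∃ t : R, ∀ p : ℕ, p.Prime → ¬ (p : R) ∣ y + t * x := by
  obtain ⟨t₀, ht₀⟩ := exists_avoid x y n hn (fun p hp _ => hxy p hp)
  obtain ⟨u, hu⟩ := hxn
  obtain ⟨c, hc⟩ := rep7 l hw hl (y + t₀ * x)
  set d := l (y + t₀ * x)
  obtain ⟨e, he⟩ : ∃ e : ℤ, d + n * e ≠ 0 := by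
    by_cases h : d = 0
    · exact ⟨1, by simpa [h] using hn⟩
    · exact ⟨0, by simpa using h⟩
  obtain ⟨j, hj⟩ := exists_avoid (R := ℤ) n c (d + n * e) he (by
    rintro p hp hpd ⟨h1, h2⟩
    have h1' : (p : ℤ) ∣ n := by simpa using h1
    apply ht₀ p hp h1'
    have := (dvd7 l hw hl (p : ℤ) c d).2
      ⟨by simpa using h2, (dvd_add_left (h1'.mul_right e)).1 hpd⟩
    rw [hc]
    simpa using this)
  refine ⟨t₀ + u * (j + e * w), fun p hp hd => ?_⟩
  have heq : y + (t₀ + u * (j + e * w)) * x = ((c + j * n : ℤ) : R) + ((d + n * e : ℤ) : R) * w := by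
    have : y + (t₀ + u * (j + e * w)) * x = (y + t₀ * x) + (x * u) * (j + e * w) := by ring
    rw [this, ← hu, hc]
    push_cast
    ring
  rw [heq] at hd
  have hd' : ((p : ℤ) : R) ∣ ((c + j * n : ℤ) : R) + ((d + n * e : ℤ) : R) * w := by
    simpa using hd
  obtain ⟨h1, h2⟩ := (dvd7 l hw hl _ _ _).1 hd'
  exact hj p hp h2 (by simpa using h1)

lemma content7 (x y : R) (hx : x ≠ 0) : ∃ (g : ℤ) (x' y' : R), x = g * x' ∧ y = g * y' ∧
    ∀ p : ℕ, p.Prime → ¬ ((p : R) ∣ x' ∧ (p : R) ∣ y') := by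
  obtain ⟨a, ha⟩ := rep7 l hw hl x
  obtain ⟨c, hc⟩ := rep7 l hw hl y
  set b := l x
  set d := l y
  let g : ℤ := gcd (gcd a b) (gcd c d)
  have g1 : g ∣ a := (gcd_dvd_left _ _).trans (gcd_dvd_left _ _)
  have g2 : g ∣ b := (gcd_dvd_left _ _).trans (gcd_dvd_right _ _)
  have g3 : g ∣ c := (gcd_dvd_right _ _).trans (gcd_dvd_left _ _)
  have g4 : g ∣ d := (gcd_dvd_right _ _).trans (gcd_dvd_right _ _)
  obtain ⟨x', hx'⟩ := (dvd7 l hw hl g a b).2 ⟨g1, g2⟩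
  obtain ⟨y', hy'⟩ := (dvd7 l hw hl g c d).2 ⟨g3, g4⟩
  rw [← ha] at hx'
  rw [← hc] at hy'
  refine ⟨g, x', y', hx', hy', ?_⟩
  rintro p hp ⟨h1, h2⟩
  have hg0 : g ≠ 0 := by
    intro h0
    apply hx
    rw [hx', h0]; simp
  have k1 : ((g * p : ℤ) : R) ∣ a + b * w := by
    rw [← ha, hx']; push_cast; exact mul_dvd_mul_left _ h1
  have k2 : ((g * p : ℤ) : R) ∣ c + d * w := by
    rw [← hc, hy']; push_cast; exact mul_dvd_mul_left _ h2
  rw [dvd7 l hw hl] at k1 k2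
  have k : g * p ∣ g * 1 := by
    rw [mul_one]
    exact dvd_gcd (dvd_gcd k1.1 k1.2) (dvd_gcd k2.1 k2.2)
  have := (mul_dvd_mul_iff_left hg0).1 k
  have h5 := Int.natCast_dvd_natCast.1 (by simpa using this : (p : ℤ) ∣ ((1 : ℕ) : ℤ))
  exact hp.one_lt.ne' (Nat.dvd_one.1 h5)

end Main

/-- For `ℚ(√α)` with α ≡ 1 (mod 4): for all `x, y ∈ O_k` there exist `h ∈ ℤ` and
`β ∈ O_k` such that if `[h β] ∈ EBIG^n_m(O_k)` then `[x y] ∈ EBIG^{n+3}_{m+24}(O_k)`. -/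
theorem stmt_7 (α : ℤ) (hαpos : 0 < α) (hαsf : Squarefree α)
    (hαmod : α % 4 = 1)
    (K : Type*) [Field K] [NumberField K]
    (hrank : Module.finrank ℚ K = 2) (hsqrt : ∃ s : K, s * s = (α : K))
    (x y : 𝓞 K) (m n : ℕ) (hm : 0 < m) :
    ∃ (h : ℤ) (β : 𝓞 K),
      EBIG n m (!![(h : 𝓞 K), β; 0, 0] : Matrix (Fin 2) (Fin 2) (𝓞 K)) →
      EBIG (n + 3) (m + 24) (!![x, y; 0, 0] : Matrix (Fin 2) (Fin 2) (𝓞 K)) := by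
  obtain ⟨l, ⟨w, hw⟩, hl⟩ := exists_functional K hrank
  by_cases hx : x = 0
  · refine ⟨0, y, fun H => ?_⟩
    subst hx
    have := (PI7.of_EBIG H).mono (Nat.le_add_right m 24)
    exact PI7.to_EBIG (by simpa using this)
  obtain ⟨g, x', y', rfl, rfl, hp⟩ := content7 l hw hl x y hx
  have hx' : x' ≠ 0 := right_ne_zero_of_mul hx
  obtain ⟨N, hN0, hN⟩ : ∃ N : ℤ, N ≠ 0 ∧ x' ∣ (N : 𝓞 K) := by
    refine ⟨(Ideal.absNorm (Ideal.span {x'}) : ℕ), ?_, ?_⟩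
    · simpa [Ideal.absNorm_eq_zero_iff] using hx'
    · have := Ideal.absNorm_mem (Ideal.span {x'})
      rw [Ideal.mem_span_singleton] at this
      simpa using this
  obtain ⟨t, ht⟩ := exists_prim7 l hw hl x' y' N hN0 hN hp
  obtain ⟨s, h, hs⟩ := to_int7 l hw hl x' (y' + t * x') ht
  refine ⟨g * h, g * (y' + t * x'), fun H => ?_⟩
  have h1 := ((PI7.of_EBIG H).swap.shear (-s)).swap.shear (-t)
  apply PI7.to_EBIG
  have h2 := h1.mono (show m + 1 + 1 ≤ m + 24 by omega)
  have e1 : ((g * h : ℤ) : 𝓞 K) + -s * (g * (y' + t * x')) = g * x' := by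
    push_cast
    rw [← hs]; ring
  rw [e1] at h2
  have e2 : (g : 𝓞 K) * (y' + t * x') + -t * (g * x') = g * y' := by ring
  rw [e2] at h2
  exact h2
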